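/- For stationary ergodic measures μ and ν on finite-alphabet sequence spaces, the optimal joining cost S(μ,ν) equals the optimal transport cost T_{c̄}(μ,ν) with respect to the limiting average cost c̄. -/

import Mathlib

open MeasureTheory Filter Topology

noncomputable section

/-- The left shift on sequence space. -/
def shiftMap (U : Type*) : (ℕ → U) → (ℕ → U) := fun x n => x (n + 1)

/-- A measure on sequence space is stationary if it is invariant under the left shift. -/
def Stationary {U : Type*} [MeasurableSpace U] (μ : Measure (ℕ → U)) : Prop :=
  μ.map (shiftMap U) = μ

/-- The joint left shift on a product of two sequence spaces. -/
def shiftMap2 (X Y : Type*) : (ℕ → X) × (ℕ → Y) → (ℕ → X) × (ℕ → Y) :=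
  fun p => (shiftMap X p.1, shiftMap Y p.2)

/-- `λ` is a joining of `μ` and `ν`: a coupling that is invariant under the joint shift. -/
def IsJoining {X Y : Type*} [MeasurableSpace X] [MeasurableSpace Y]
    (lam : Measure ((ℕ → X) × (ℕ → Y))) (μ : Measure (ℕ → X)) (ν : Measure (ℕ → Y)) : Prop :=
  lam.map Prod.fst = μ ∧ lam.map Prod.snd = ν ∧ lam.map (shiftMap2 X Y) = lam

/-- The expected one-letter cost of a coupling of processes. -/
def costOne {X Y : Type*} [MeasurableSpace X] [MeasurableSpace Y] (c : X → Y → ℝ)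
    (lam : Measure ((ℕ → X) × (ℕ → Y))) : ℝ :=
  ∫ p, c (p.1 0) (p.2 0) ∂lam

/-- The optimal joining cost. -/
def ojCost {X Y : Type*} [MeasurableSpace X] [MeasurableSpace Y] (c : X → Y → ℝ)
    (μ : Measure (ℕ → X)) (ν : Measure (ℕ → Y)) : ℝ :=
  sInf (costOne c '' {lam | IsJoining lam μ ν})

/-- The limiting average cost. -/
def cbar {X Y : Type*} (c : X → Y → ℝ) (x : ℕ → X) (y : ℕ → Y) : ℝ :=
  limsup (fun k : ℕ => (∑ l ∈ Finset.range k, c (x l) (y l)) / k) atTop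

/-- Optimal transport cost between two measures. -/
def otCost {U V : Type*} [MeasurableSpace U] [MeasurableSpace V] (c : U → V → ℝ)
    (α : Measure U) (β : Measure V) : ℝ :=
  sInf ((fun π : Measure (U × V) => ∫ p, c p.1 p.2 ∂π) ''
    {π | π.map Prod.fst = α ∧ π.map Prod.snd = β})

/-- Shannon entropy of a measure on a finite space. -/
def shEntropy {U : Type*} [Fintype U] [MeasurableSpace U] (α : Measure U) : ℝ :=
  -∑ u : U, ((α {u}).toReal * Real.log (α {u}).toReal)

/-- Entropic optimal transport cost. -/
def eotCost {U V : Type*} [Fintype U] [Fintype V] [MeasurableSpace U] [MeasurableSpace V]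
    (η : ℝ) (c : U → V → ℝ) (α : Measure U) (β : Measure V) : ℝ :=
  sInf ((fun π : Measure (U × V) => (∫ p, c p.1 p.2 ∂π) - η * shEntropy π) ''
    {π | π.map Prod.fst = α ∧ π.map Prod.snd = β})

/-- The `k`-dimensional marginal of a process measure. -/
def marginal {U : Type*} [MeasurableSpace U] (k : ℕ) (μ : Measure (ℕ → U)) :
    Measure (Fin k → U) :=
  μ.map (fun x (i : Fin k) => x (i : ℕ))

/-- The `k`-step additive cost. -/
def ck {X Y : Type*} (c : X → Y → ℝ) (k : ℕ) : (Fin k → X) → (Fin k → Y) → ℝ :=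
  fun a b => ∑ i, c (a i) (b i)

/-- The `k`-dimensional marginal of a measure on a product of sequence spaces. -/
def marginal2 {X Y : Type*} [MeasurableSpace X] [MeasurableSpace Y] (k : ℕ)
    (lam : Measure ((ℕ → X) × (ℕ → Y))) : Measure ((Fin k → X) × (Fin k → Y)) :=
  lam.map (fun p => (fun i : Fin k => p.1 (i : ℕ), fun i : Fin k => p.2 (i : ℕ)))

/-- Entropy rate of a process measure on a finite alphabet. -/
def entropyRate {U : Type*} [Fintype U] [MeasurableSpace U] (γ : Measure (ℕ → U)) : ℝ :=
  limsup (fun k : ℕ => shEntropy (marginal k γ) / k) atTop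

/-- Entropy rate of a joint process measure. -/
def entropyRate2 {X Y : Type*} [Fintype X] [Fintype Y] [MeasurableSpace X] [MeasurableSpace Y]
    (lam : Measure ((ℕ → X) × (ℕ → Y))) : ℝ :=
  limsup (fun k : ℕ => shEntropy (marginal2 k lam) / k) atTop

/-- The entropic optimal joining cost. -/
def eojCost {X Y : Type*} [Fintype X] [Fintype Y] [MeasurableSpace X] [MeasurableSpace Y]
    (η : ℝ) (c : X → Y → ℝ) (μ : Measure (ℕ → X)) (ν : Measure (ℕ → Y)) : ℝ :=
  sInf ((fun lam => costOne c lam - η * entropyRate2 lam) '' {lam | IsJoining lam μ ν})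

/-- `ρ` is the independent `k`-block process induced by `γ`: every `m·k`-dimensional marginal,
grouped into `m` blocks of length `k`, is the `m`-fold product of `γ`. -/
def IsIndepBlock {U : Type*} [MeasurableSpace U] (k : ℕ) (γ : Measure (Fin k → U))
    (ρ : Measure (ℕ → U)) : Prop :=
  IsProbabilityMeasure ρ ∧
    ∀ m : ℕ, ρ.map (fun x (j : Fin m) (i : Fin k) => x (j * k + i)) =
      Measure.pi (fun _ : Fin m => γ)

/-- Randomizing the start of a process over the first `k` coordinates. -/
def randStart {U : Type*} [MeasurableSpace U] (k : ℕ) (ρ : Measure (ℕ → U)) :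
    Measure (ℕ → U) :=
  (k : ENNReal)⁻¹ • ∑ l ∈ Finset.range k, ρ.map ((shiftMap U)^[l])


section BirkhoffBounds

variable {Ω : Type*} {T : Ω → Ω} {f : Ω → ℝ} {C : ℝ}

lemma birkhoffAverage_eq_div (T : Ω → Ω) (f : Ω → ℝ) (n : ℕ) (ω : Ω) :
    birkhoffAverage ℝ T f n ω = (∑ l ∈ Finset.range n, f (T^[l] ω)) / n := by
  rw [birkhoffAverage, birkhoffSum, smul_eq_mul, div_eq_inv_mul]

lemma birkhoffAverage_nonneg (h0 : ∀ ω, 0 ≤ f ω) (n : ℕ) (ω : Ω) :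
    0 ≤ birkhoffAverage ℝ T f n ω := by
  rw [birkhoffAverage_eq_div]
  exact div_nonneg (Finset.sum_nonneg fun _ _ => h0 _) n.cast_nonneg

lemma birkhoffAverage_le (hC0 : 0 ≤ C) (hC : ∀ ω, f ω ≤ C) (n : ℕ) (ω : Ω) :
    birkhoffAverage ℝ T f n ω ≤ C := by
  rw [birkhoffAverage_eq_div]
  refine div_le_of_le_mul₀ n.cast_nonneg hC0 ?_
  calc ∑ l ∈ Finset.range n, f (T^[l] ω) ≤ ∑ _l ∈ Finset.range n, C :=
        Finset.sum_le_sum fun _ _ => hC _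
    _ = C * n := by simp [mul_comm]

lemma isBoundedUnder_le_birkhoffAverage (hC0 : 0 ≤ C) (hC : ∀ ω, f ω ≤ C) (ω : Ω) :
    IsBoundedUnder (· ≤ ·) atTop (fun k => birkhoffAverage ℝ T f k ω) :=
  isBoundedUnder_of ⟨C, fun n => birkhoffAverage_le hC0 hC n ω⟩

lemma isBoundedUnder_ge_birkhoffAverage (h0 : ∀ ω, 0 ≤ f ω) (ω : Ω) :
    IsBoundedUnder (· ≥ ·) atTop (fun k => birkhoffAverage ℝ T f k ω) :=
  isBoundedUnder_of ⟨0, fun n => birkhoffAverage_nonneg h0 n ω⟩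

/-- The upper limit of the Birkhoff averages of `f` along the orbits of `T`. -/
def birkhoffLimsup (T : Ω → Ω) (f : Ω → ℝ) (ω : Ω) : ℝ :=
  limsup (fun k => birkhoffAverage ℝ T f k ω) atTop

lemma birkhoffLimsup_nonneg (h0 : ∀ ω, 0 ≤ f ω) (hC : ∀ ω, f ω ≤ C) (ω : Ω) :
    0 ≤ birkhoffLimsup T f ω :=
  le_limsup_of_frequently_le (Frequently.of_forall fun n => birkhoffAverage_nonneg h0 n ω)
    (isBoundedUnder_le_birkhoffAverage ((h0 ω).trans (hC ω)) hC ω)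

lemma birkhoffLimsup_le (h0 : ∀ ω, 0 ≤ f ω) (hC : ∀ ω, f ω ≤ C) (ω : Ω) :
    birkhoffLimsup T f ω ≤ C :=
  limsup_le_of_le (isBoundedUnder_ge_birkhoffAverage h0 ω).isCoboundedUnder_le
    (Eventually.of_forall fun n => birkhoffAverage_le ((h0 ω).trans (hC ω)) hC n ω)

lemma birkhoffLimsup_apply (h0 : ∀ ω, 0 ≤ f ω) (hC : ∀ ω, f ω ≤ C) (ω : Ω) :
    birkhoffLimsup T f (T ω) = birkhoffLimsup T f ω := by
  have hbdd : Bornology.IsBounded (Set.range fun n => f (T^[n] ω)) :=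
    (Metric.isBounded_Icc 0 C).subset (Set.range_subset_iff.2 fun n => ⟨h0 _, hC _⟩)
  have hlim := tendsto_birkhoffAverage_apply_sub_birkhoffAverage (𝕜 := ℝ) hbdd
  have hC0 := (h0 ω).trans (hC ω)
  have b1 := fun ω => isBoundedUnder_le_birkhoffAverage (T := T) hC0 hC ω
  have b2 := fun ω => isBoundedUnder_ge_birkhoffAverage (T := T) h0 ω
  have hle : ∀ a b : Ω, Tendsto (fun n => birkhoffAverage ℝ T f n a - birkhoffAverage ℝ T f n b)
      atTop (𝓝 0) → birkhoffLimsup T f a ≤ birkhoffLimsup T f b := by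
    intro a b h
    refine le_of_forall_pos_lt_add fun ε hε => ?_
    have e1 := eventually_lt_of_limsup_lt
      (lt_add_of_pos_right (birkhoffLimsup T f b) (half_pos (half_pos hε))) (b1 b)
    have e2 := h.eventually (gt_mem_nhds (half_pos (half_pos hε)))
    refine lt_of_le_of_lt (limsup_le_of_le (b2 a).isCoboundedUnder_le
      (a := birkhoffLimsup T f b + ε / 2) ?_) (by linarith)
    filter_upwards [e1, e2] with n h1 h2
    linarith
  refine le_antisymm (hle _ _ hlim) (hle _ _ ?_)
  simpa using hlim.neg

lemma exists_mul_birkhoffLimsup_sub_le_birkhoffSum (h0 : ∀ ω, 0 ≤ f ω) {ε : ℝ} (hε : 0 < ε)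
    (ω : Ω) : ∃ n : ℕ, 1 ≤ n ∧ n * (birkhoffLimsup T f ω - ε) ≤ birkhoffSum T f n ω := by
  have hf : ∃ᶠ n in atTop, birkhoffLimsup T f ω - ε < birkhoffAverage ℝ T f n ω :=
    frequently_lt_of_lt_limsup (isBoundedUnder_ge_birkhoffAverage h0 ω).isCoboundedUnder_le
      (sub_lt_self _ hε)
  obtain ⟨n, hn, hn1⟩ := (hf.and_eventually (eventually_ge_atTop 1)).exists
  refine ⟨n, hn1, ?_⟩
  rw [birkhoffAverage_eq_div, lt_div_iff₀ (by exact_mod_cast hn1)] at hn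
  rw [birkhoffSum]
  linarith

/-- If from every point some block of length at most `M` has `f`-sum at least its length times an
invariant function `g ≤ C`, then all long sums are at least their length times `g`, up to a
bounded error. -/
lemma mul_sub_le_birkhoffSum (h0 : ∀ ω, 0 ≤ f ω) {g : Ω → ℝ} (hg : ∀ ω, g (T ω) = g ω)
    (hC0 : 0 ≤ C) (hgC : ∀ ω, g ω ≤ C) {M : ℕ}
    (h : ∀ ω, ∃ n, 1 ≤ n ∧ n ≤ M ∧ n * g ω ≤ birkhoffSum T f n ω) (L : ℕ) (ω : Ω) :
    L * g ω - M * C ≤ birkhoffSum T f L ω := by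
  induction L using Nat.strong_induction_on generalizing ω with
  | _ L ih =>
    obtain ⟨n, hn1, hnM, hn⟩ := h ω
    rcases lt_or_ge L n with hL | hL
    · have hpos : 0 ≤ birkhoffSum T f L ω := Finset.sum_nonneg fun _ _ => h0 _
      have h1 : (L : ℝ) * g ω ≤ L * C := mul_le_mul_of_nonneg_left (hgC ω) L.cast_nonneg
      have h2 : (L : ℝ) * C ≤ M * C :=
        mul_le_mul_of_nonneg_right (by exact_mod_cast (hL.le.trans hnM)) hC0
      linarith
    · obtain ⟨m, rfl⟩ := Nat.exists_eq_add_of_le hL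
      have hgn : ∀ n : ℕ, g (T^[n] ω) = g ω := fun n => by
        induction n with
        | zero => rfl
        | succ n ihn => rw [Function.iterate_succ_apply', hg, ihn]
      have := ih m (by omega) (T^[n] ω)
      rw [hgn] at this
      rw [birkhoffSum_add]
      push_cast
      linarith

end BirkhoffBounds

section MaximalInequality

variable {Ω : Type*} [MeasurableSpace Ω] {P : Measure Ω} {T : Ω → Ω} {f : Ω → ℝ} {C : ℝ}

lemma measurable_birkhoffSum (hT : Measurable T) (hf : Measurable f) (n : ℕ) :
    Measurable (birkhoffSum T f n) :=
  Finset.measurable_fun_sum _ fun l _ => hf.comp (hT.iterate l)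

lemma measurable_birkhoffAverage (hT : Measurable T) (hf : Measurable f) (n : ℕ) :
    Measurable (birkhoffAverage ℝ T f n) :=
  (measurable_birkhoffSum hT hf n).const_smul (n : ℝ)⁻¹

lemma measurable_birkhoffLimsup (hT : Measurable T) (hf : Measurable f) :
    Measurable (birkhoffLimsup T f) :=
  Measurable.limsup fun n => measurable_birkhoffAverage hT hf n

lemma integrable_of_nonneg_of_le [IsFiniteMeasure P] (hf : Measurable f) (h0 : ∀ ω, 0 ≤ f ω)
    (hC : ∀ ω, f ω ≤ C) : Integrable f P :=
  Integrable.of_bound hf.aestronglyMeasurable C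
    (Eventually.of_forall fun ω => by rw [Real.norm_of_nonneg (h0 ω)]; exact hC ω)

lemma integral_birkhoffSum (hT : MeasurePreserving T P P) (hf : Integrable f P) (n : ℕ) :
    ∫ ω, birkhoffSum T f n ω ∂P = n * ∫ ω, f ω ∂P := by
  have hi : ∀ l, MeasurePreserving T^[l] P P := fun l => hT.iterate l
  simp only [birkhoffSum]
  rw [integral_finsetSum (f := fun l ω => f (T^[l] ω)) _
    fun l _ => (hi l).integrable_comp_of_integrable hf]
  have : ∀ l, ∫ ω, f (T^[l] ω) ∂P = ∫ ω, f ω ∂P := fun l => by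
    conv_rhs => rw [← (hi l).map_eq]
    rw [integral_map (hi l).measurable.aemeasurable]
    rw [(hi l).map_eq]; exact hf.aestronglyMeasurable
  simp [this]

lemma le_of_forall_nat_mul_le_add {a b K : ℝ} (h : ∀ n : ℕ, n * a ≤ n * b + K) : a ≤ b := by
  by_contra! hab
  obtain ⟨n, hn⟩ := exists_nat_gt (K / (a - b))
  have := h n
  rw [div_lt_iff₀ (sub_pos.2 hab)] at hn
  linarith

/-- One half of the pointwise ergodic theorem: the upper limit of the Birkhoff averages has
integral at most that of the observable. -/
theorem integral_birkhoffLimsup_le [IsProbabilityMeasure P] (hT : MeasurePreserving T P P)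
    (hf : Measurable f) (h0 : ∀ ω, 0 ≤ f ω) (hC : ∀ ω, f ω ≤ C) :
    ∫ ω, birkhoffLimsup T f ω ∂P ≤ ∫ ω, f ω ∂P := by
  have : Nonempty Ω := nonempty_of_isProbabilityMeasure P
  have hC0 : 0 ≤ C := (h0 (Classical.arbitrary Ω)).trans (hC _)
  set g := birkhoffLimsup T f with hg
  have hgm : Measurable g := measurable_birkhoffLimsup hT.measurable hf
  have hgi : Integrable g P :=
    integrable_of_nonneg_of_le hgm (birkhoffLimsup_nonneg h0 hC) (birkhoffLimsup_le h0 hC)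
  have hfi : Integrable f P := integrable_of_nonneg_of_le hf h0 hC
  refine le_of_forall_pos_le_add fun ε hε => ?_
  let B : ℕ → Set Ω := fun M =>
    ⋂ n ∈ Set.Icc 1 M, {ω | birkhoffSum T f n ω < n * (g ω - ε)}
  have hBm : ∀ M, MeasurableSet (B M) := fun M =>
    MeasurableSet.biInter (Set.to_countable _) fun n _ =>
      measurableSet_lt (measurable_birkhoffSum hT.measurable hf n)
        ((hgm.sub_const ε).const_mul _)
  have hBanti : Antitone B := fun M N hMN =>
    Set.biInter_subset_biInter_left (Set.Icc_subset_Icc_right hMN)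
  have hBempty : ⋂ M, B M = ∅ := by
    refine Set.eq_empty_of_forall_notMem fun ω hω => ?_
    obtain ⟨n, hn1, hn⟩ := exists_mul_birkhoffLimsup_sub_le_birkhoffSum (T := T) h0 hε ω
    have := Set.mem_iInter₂.1 (Set.mem_iInter.1 hω n) n ⟨hn1, le_rfl⟩
    exact absurd hn (not_le.2 this)
  have hlim : Tendsto (fun M => P.real (B M)) atTop (𝓝 0) := by
    have := tendsto_measure_iInter_atTop (μ := P) (fun M => (hBm M).nullMeasurableSet) hBanti
      ⟨0, measure_ne_top _ _⟩
    rw [hBempty, measure_empty] at this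
    exact (ENNReal.tendsto_toReal ENNReal.zero_ne_top).comp this
  have key : ∀ M, ∫ ω, g ω ∂P - ε ≤ ∫ ω, f ω ∂P + C * P.real (B (M + 1)) := by
    intro M
    let f' : Ω → ℝ := fun ω => f ω + (B (M + 1)).indicator (fun _ => C) ω
    have hind : Integrable ((B (M + 1)).indicator fun _ => C) P :=
      (integrable_const C).indicator (hBm _)
    have hff' : ∀ ω, f ω ≤ f' ω := fun ω =>
      le_add_of_nonneg_right (Set.indicator_nonneg (fun _ _ => hC0) ω)
    have hf'i : Integrable f' P := hfi.add hind
    have hf'int : ∫ ω, f' ω ∂P = ∫ ω, f ω ∂P + C * P.real (B (M + 1)) := by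
      rw [integral_add hfi hind, integral_indicator_const _ (hBm _), smul_eq_mul, mul_comm]
    have hblock : ∀ ω, ∃ n, 1 ≤ n ∧ n ≤ M + 1 ∧ n * (g ω - ε) ≤ birkhoffSum T f' n ω := by
      intro ω
      by_cases hω : ω ∈ B (M + 1)
      · refine ⟨1, le_rfl, by omega, ?_⟩
        have h1 : g ω ≤ C := birkhoffLimsup_le h0 hC ω
        have h2 := h0 ω
        simp only [Nat.cast_one, one_mul, birkhoffSum_one, f', Set.indicator_of_mem hω]
        linarith
      · simp only [B, Set.mem_iInter, Set.mem_ofPred_eq, not_forall, not_lt] at hω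
        obtain ⟨n, ⟨hn1, hn2⟩, hn⟩ := hω
        exact ⟨n, hn1, hn2, hn.trans (Finset.sum_le_sum fun _ _ => hff' _)⟩
    rw [← hf'int]
    refine le_of_forall_nat_mul_le_add (K := (M + 1 : ℕ) * C) fun L => ?_
    rw [← integral_birkhoffSum hT hf'i L, ← sub_le_iff_le_add]
    have hpt : ∀ ω, L * (g ω - ε) - (M + 1 : ℕ) * C ≤ birkhoffSum T f' L ω := fun ω =>
      mul_sub_le_birkhoffSum (g := fun ω => g ω - ε) (fun ω => (h0 ω).trans (hff' ω))
        (fun ω => by simp only [hg, birkhoffLimsup_apply h0 hC]) hC0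
        (fun ω => by linarith [birkhoffLimsup_le (T := T) h0 hC ω]) hblock L ω
    have hgε : Integrable (fun ω => L * (g ω - ε)) P :=
      (hgi.sub (integrable_const ε)).const_mul _
    have hl : ∫ ω, (L * (g ω - ε) - (M + 1 : ℕ) * C) ∂P
        = L * (∫ ω, g ω ∂P - ε) - (M + 1 : ℕ) * C := by
      rw [integral_sub hgε (integrable_const _),
        integral_const_mul, integral_sub hgi (integrable_const ε)]
      simp
    rw [← hl]
    refine integral_mono ?_ ?_ hpt
    · exact hgε.sub (integrable_const _)
    · exact integrable_finsetSum _ fun l _ =>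
        (hT.iterate l).integrable_comp_of_integrable hf'i
  have hlim' : Tendsto (fun M => ∫ ω, f ω ∂P + C * P.real (B (M + 1))) atTop
      (𝓝 (∫ ω, f ω ∂P + C * 0)) :=
    ((hlim.comp (tendsto_add_atTop_nat 1)).const_mul C).const_add _
  have := ge_of_tendsto' hlim' key
  linarith

/-- A form of the reverse Fatou lemma along an ultrafilter. -/
lemma le_integral_birkhoffLimsup [IsFiniteMeasure P] (hT : Measurable T)
    (hf : Measurable f) (h0 : ∀ ω, 0 ≤ f ω) (hC : ∀ ω, f ω ≤ C) {l : Filter ℕ} [l.NeBot]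
    (hl : l ≤ atTop) {a : ℝ}
    (ha : Tendsto (fun k => ∫ ω, birkhoffAverage ℝ T f k ω ∂P) l (𝓝 a)) :
    a ≤ ∫ ω, birkhoffLimsup T f ω ∂P := by
  have hAm := measurable_birkhoffAverage hT hf
  have hgm := measurable_birkhoffLimsup hT hf
  have hg0 := birkhoffLimsup_nonneg (T := T) h0 hC
  have hgC := birkhoffLimsup_le (T := T) h0 hC
  have hAC : ∀ n ω, birkhoffAverage ℝ T f n ω ≤ C := fun n ω =>
    birkhoffAverage_le ((h0 ω).trans (hC ω)) hC n ω
  have hlim : Tendsto (fun k => ∫ ω, max (birkhoffAverage ℝ T f k ω) (birkhoffLimsup T f ω) ∂P)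
      atTop (𝓝 (∫ ω, birkhoffLimsup T f ω ∂P)) := by
    refine tendsto_integral_of_dominated_convergence (fun _ => C)
      (fun n => ((hAm n).max hgm).aestronglyMeasurable) (integrable_const C)
      (fun n => Eventually.of_forall fun ω => ?_) (Eventually.of_forall fun ω => ?_)
    · rw [Real.norm_of_nonneg (le_max_of_le_right (hg0 ω))]
      exact max_le (hAC n ω) (hgC ω)
    · refine tendsto_order.2 ⟨fun b hb => Eventually.of_forall fun n => lt_max_of_lt_right hb,
        fun b hb => ?_⟩
      filter_upwards [eventually_lt_of_limsup_lt hb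
        (isBoundedUnder_le_birkhoffAverage ((h0 ω).trans (hC ω)) hC ω)] with n hn
      exact max_lt hn hb
  refine le_of_tendsto_of_tendsto' ha (hlim.mono_left hl) fun n => integral_mono ?_ ?_
    fun ω => le_max_left _ _
  · exact integrable_of_nonneg_of_le (hAm n) (birkhoffAverage_nonneg h0 n) (hAC n)
  · exact integrable_of_nonneg_of_le ((hAm n).max hgm)
      (fun ω => le_max_of_le_right (hg0 ω)) fun ω => max_le (hAC n ω) (hgC ω)

end MaximalInequality

section InvariantLimit

open scoped BoundedContinuousFunction

variable {Ω : Type*} [MeasurableSpace Ω] {P : Measure Ω} {T : Ω → Ω}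

/-- The average of the images of `P` under the first `n` iterates of `T`. -/
def orbitAverage (T : Ω → Ω) (P : Measure Ω) (n : ℕ) : Measure Ω :=
  (n : ENNReal)⁻¹ • ∑ l ∈ Finset.range n, P.map T^[l]

lemma isProbabilityMeasure_orbitAverage [IsProbabilityMeasure P] (hT : Measurable T) {n : ℕ}
    (hn : n ≠ 0) : IsProbabilityMeasure (orbitAverage T P n) := by
  constructor
  have : ∀ l, (P.map T^[l]) Set.univ = 1 := fun l => by
    rw [Measure.map_apply (hT.iterate l) MeasurableSet.univ]; simp
  simp only [orbitAverage, Measure.smul_apply, Measure.finsetSum_apply, this, smul_eq_mul,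
    Finset.sum_const, Finset.card_range, nsmul_eq_mul, mul_one]
  exact ENNReal.inv_mul_cancel (by exact_mod_cast hn) (ENNReal.natCast_ne_top n)

lemma integral_orbitAverage [IsProbabilityMeasure P] (hT : Measurable T) {φ : Ω → ℝ}
    (hφ : Measurable φ) {C : ℝ} (hC : ∀ ω, ‖φ ω‖ ≤ C) (n : ℕ) :
    ∫ ω, φ ω ∂(orbitAverage T P n) = ∫ ω, birkhoffAverage ℝ T φ n ω ∂P := by
  have hφint : ∀ (Q : Measure Ω) [IsProbabilityMeasure Q], Integrable φ Q := fun Q _ =>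
    Integrable.of_bound hφ.aestronglyMeasurable C (Eventually.of_forall hC)
  have hprob : ∀ l, IsProbabilityMeasure (P.map T^[l]) := fun l =>
    Measure.isProbabilityMeasure_map (hT.iterate l).aemeasurable
  rw [orbitAverage, integral_smul_measure, integral_finsetSum_measure fun l _ => hφint _]
  simp only [birkhoffAverage, birkhoffSum, smul_eq_mul, integral_const_mul]
  rw [integral_finsetSum (f := fun l ω => φ (T^[l] ω)) _ fun l _ =>
    Integrable.of_bound (hφ.comp (hT.iterate l)).aestronglyMeasurable C
      (Eventually.of_forall fun _ => hC _)]
  congr 1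
  · simp
  · exact Finset.sum_congr rfl fun l _ =>
      integral_map (hT.iterate l).aemeasurable hφ.aestronglyMeasurable


/-- Krylov–Bogoliubov: the averages of a probability measure along the iterates of a continuous
map accumulate at an invariant probability measure. -/
theorem exists_invariant_limit_orbitAverage [TopologicalSpace Ω] [CompactSpace Ω] [T2Space Ω]
    [BorelSpace Ω] [HasOuterApproxClosed Ω] [IsProbabilityMeasure P] (hT : Continuous T) :
    ∃ (l : Filter ℕ) (Q : Measure Ω), l.NeBot ∧ l ≤ atTop ∧ IsProbabilityMeasure Q ∧
      Q.map T = Q ∧ ∀ φ : Ω →ᵇ ℝ,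
        Tendsto (fun n => ∫ ω, birkhoffAverage ℝ T φ n ω ∂P) l (𝓝 (∫ ω, φ ω ∂Q)) := by
  have hTm : Measurable T := hT.measurable
  let q : ℕ → ProbabilityMeasure Ω := fun n =>
    ⟨orbitAverage T P (n + 1), isProbabilityMeasure_orbitAverage hTm n.succ_ne_zero⟩
  let U : Ultrafilter ℕ := hyperfilter ℕ
  obtain ⟨Q, hQ⟩ : ∃ Q, Tendsto q U (𝓝 Q) :=
    ⟨(U.map q).lim, (U.map q).le_nhds_lim⟩
  have hU : (U : Filter ℕ) ≤ atTop := by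
    rw [← Nat.cofinite_eq_atTop]; exact hyperfilter_le_cofinite
  let l : Filter ℕ := (U : Filter ℕ).map (· + 1)
  have hl : l ≤ atTop := (tendsto_add_atTop_nat 1).mono_left hU
  have hlim : ∀ φ : Ω →ᵇ ℝ,
      Tendsto (fun n => ∫ ω, birkhoffAverage ℝ T φ n ω ∂P) l (𝓝 (∫ ω, φ ω ∂(Q : Measure Ω))) := by
    intro φ
    have := ProbabilityMeasure.tendsto_iff_forall_integral_tendsto.1 hQ φ
    rw [tendsto_map'_iff]
    refine this.congr fun n => ?_
    exact integral_orbitAverage hTm φ.continuous.measurable φ.norm_coe_le_norm (n + 1)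
  refine ⟨l, Q, inferInstance, hl, inferInstance, ?_, hlim⟩
  have : IsProbabilityMeasure ((Q : Measure Ω).map T) :=
    Measure.isProbabilityMeasure_map hTm.aemeasurable
  refine ext_of_forall_integral_eq_of_IsFiniteMeasure fun φ => ?_
  rw [integral_map hTm.aemeasurable φ.continuous.measurable.aestronglyMeasurable]
  have h1 := hlim (φ.compContinuous ⟨T, hT⟩)
  have h2 := hlim φ
  have hdiff : Tendsto (fun n => ∫ ω, birkhoffAverage ℝ T (φ.compContinuous ⟨T, hT⟩) n ω ∂P
      - ∫ ω, birkhoffAverage ℝ T φ n ω ∂P) atTop (𝓝 0) := by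
    have hb : ∀ n : ℕ, ‖∫ ω, birkhoffAverage ℝ T (φ.compContinuous ⟨T, hT⟩) n ω ∂P
      - ∫ ω, birkhoffAverage ℝ T φ n ω ∂P‖ ≤ 2 * ‖φ‖ / n := by
      intro n
      have hi : ∀ ψ : Ω →ᵇ ℝ, Integrable (birkhoffAverage ℝ T ψ n) P := fun ψ => by
        refine Integrable.smul (n : ℝ)⁻¹ (integrable_finsetSum (f := fun k ω => ψ (T^[k] ω)) _
          fun k _ => ?_)
        exact Integrable.of_bound (ψ.continuous.comp (hT.iterate k)).aestronglyMeasurable ‖ψ‖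
          (Eventually.of_forall fun _ => ψ.norm_coe_le_norm _)
      rw [← integral_sub (hi _) (hi _)]
      refine (norm_integral_le_of_norm_le_const (C := 2 * ‖φ‖ / n)
        (Eventually.of_forall fun ω => ?_)).trans_eq (by simp)
      have hcomp : birkhoffAverage ℝ T (φ.compContinuous ⟨T, hT⟩) n ω
          = birkhoffAverage ℝ T φ n (T ω) := by
        simp only [birkhoffAverage_eq_div, BoundedContinuousFunction.compContinuous_apply,
          ContinuousMap.coe_mk, ← Function.iterate_succ_apply, Function.iterate_succ_apply']
      rw [hcomp, ← dist_eq_norm, dist_birkhoffAverage_apply_birkhoffAverage]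
      gcongr
      exact φ.dist_le_two_norm _ _
    exact squeeze_zero_norm hb (tendsto_const_div_atTop_nhds_zero_nat _)
  have h3 := tendsto_nhds_unique (h1.sub h2) (hdiff.mono_left hl)
  exact sub_eq_zero.1 h3

/-- Factor maps onto an already invariant marginal do not see the passage to the limit. -/
lemma map_eq_map_of_tendsto_birkhoffAverage [TopologicalSpace Ω] [BorelSpace Ω] {Ω' : Type*}
    [MeasurableSpace Ω']
    [TopologicalSpace Ω'] [BorelSpace Ω'] [HasOuterApproxClosed Ω'] [IsProbabilityMeasure P]
    {Q : Measure Ω} [IsProbabilityMeasure Q] {l : Filter ℕ} [l.NeBot] (hl : l ≤ atTop)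
    (hlim : ∀ φ : Ω →ᵇ ℝ,
      Tendsto (fun n => ∫ ω, birkhoffAverage ℝ T φ n ω ∂P) l (𝓝 (∫ ω, φ ω ∂Q)))
    {F : Ω → Ω'} (hF : Continuous F) {S : Ω' → Ω'} (hFS : Function.Semiconj F T S)
    (hS : MeasurePreserving S (P.map F) (P.map F)) : Q.map F = P.map F := by
  have hFm : Measurable F := hF.measurable
  have : IsProbabilityMeasure (Q.map F) := Measure.isProbabilityMeasure_map hFm.aemeasurable
  have : IsProbabilityMeasure (P.map F) := Measure.isProbabilityMeasure_map hFm.aemeasurable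
  refine ext_of_forall_integral_eq_of_IsFiniteMeasure fun φ => ?_
  have hφ : Measurable φ := φ.continuous.measurable
  rw [integral_map hFm.aemeasurable hφ.aestronglyMeasurable]
  have hφi : Integrable φ (P.map F) := φ.integrable _
  refine tendsto_nhds_unique (hlim (φ.compContinuous ⟨F, hF⟩)) (tendsto_const_nhds.congr' ?_)
  filter_upwards [hl (eventually_ne_atTop 0)] with n hn
  have hcomp : ∀ ω, birkhoffAverage ℝ T (φ.compContinuous ⟨F, hF⟩) n ω
      = birkhoffAverage ℝ S φ n (F ω) := fun ω => by
    simp only [birkhoffAverage_eq_div, BoundedContinuousFunction.compContinuous_apply,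
      ContinuousMap.coe_mk, (hFS.iterate_right _).eq]
  simp only [hcomp]
  rw [← integral_map hFm.aemeasurable
    (measurable_birkhoffAverage hS.measurable hφ n).aestronglyMeasurable]
  simp only [birkhoffAverage, smul_eq_mul, integral_const_mul]
  rw [integral_birkhoffSum hS hφi, inv_mul_cancel_left₀ (by exact_mod_cast hn)]

end InvariantLimit

section Joinings

variable {X Y : Type*}

/-- The observable on pairs of sequences whose orbit averages define `cbar`. -/
def firstCost (c : X → Y → ℝ) (p : (ℕ → X) × (ℕ → Y)) : ℝ := c (p.1 0) (p.2 0)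

lemma shiftMap2_iterate (n : ℕ) (p : (ℕ → X) × (ℕ → Y)) :
    (shiftMap2 X Y)^[n] p = (fun i => p.1 (i + n), fun i => p.2 (i + n)) := by
  induction n with
  | zero => rfl
  | succ n ih =>
    rw [Function.iterate_succ_apply', ih]
    simp only [shiftMap2, Prod.mk.injEq]
    constructor <;> funext i <;> simp only [shiftMap, Nat.add_right_comm i 1 n, Nat.add_assoc]

lemma firstCost_iterate (c : X → Y → ℝ) (n : ℕ) (p : (ℕ → X) × (ℕ → Y)) :
    firstCost c ((shiftMap2 X Y)^[n] p) = c (p.1 n) (p.2 n) := by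
  simp [firstCost, shiftMap2_iterate]

lemma cbar_eq_birkhoffLimsup (c : X → Y → ℝ) (p : (ℕ → X) × (ℕ → Y)) :
    cbar c p.1 p.2 = birkhoffLimsup (shiftMap2 X Y) (firstCost c) p := by
  simp only [cbar, birkhoffLimsup, birkhoffAverage_eq_div, firstCost_iterate]

lemma exists_cost_le [Finite X] [Finite Y] (c : X → Y → ℝ) : ∃ C, ∀ x y, c x y ≤ C := by
  obtain ⟨C, hC⟩ := (Set.finite_range (Function.uncurry c)).bddAbove
  exact ⟨C, fun x y => hC ⟨(x, y), rfl⟩⟩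

variable [MeasurableSpace X] [MeasurableSpace Y]

lemma measurable_shiftMap : Measurable (shiftMap X) :=
  measurable_pi_lambda _ fun n => measurable_pi_apply (n + 1)

lemma measurable_shiftMap2 : Measurable (shiftMap2 X Y) :=
  (measurable_shiftMap.comp measurable_fst).prodMk (measurable_shiftMap.comp measurable_snd)

lemma measurable_firstCost {c : X → Y → ℝ} (hc : Measurable (Function.uncurry c)) :
    Measurable (firstCost c) :=
  hc.comp (g := Function.uncurry c) (f := fun p : (ℕ → X) × (ℕ → Y) => (p.1 0, p.2 0))
    (by fun_prop)

lemma measurable_cbar {c : X → Y → ℝ} (hc : Measurable (Function.uncurry c)) :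
    Measurable fun p : (ℕ → X) × (ℕ → Y) => cbar c p.1 p.2 := by
  simp only [cbar_eq_birkhoffLimsup]
  exact measurable_birkhoffLimsup measurable_shiftMap2 (measurable_firstCost hc)

lemma isProbabilityMeasure_of_map {α β : Type*} [MeasurableSpace α] [MeasurableSpace β]
    {π : Measure α} {F : α → β} (hF : Measurable F) {μ : Measure β} [IsProbabilityMeasure μ]
    (h : π.map F = μ) : IsProbabilityMeasure π := by
  constructor
  have := measure_univ (μ := μ)
  rwa [← h, Measure.map_apply hF MeasurableSet.univ] at this

variable {μ : Measure (ℕ → X)} {ν : Measure (ℕ → Y)}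

lemma isJoining_prod [IsProbabilityMeasure μ] [IsProbabilityMeasure ν] (hμ : Stationary μ)
    (hν : Stationary ν) : IsJoining (μ.prod ν) μ ν := by
  refine ⟨by simp, by simp, ?_⟩
  exact (MeasurePreserving.prod (f := shiftMap X) (g := shiftMap Y)
    ⟨measurable_shiftMap, hμ⟩ ⟨measurable_shiftMap, hν⟩).map_eq

lemma exists_isJoining_costOne_le_of_discrete [IsProbabilityMeasure μ] [Finite X] [Finite Y]
    [DiscreteMeasurableSpace X]
    [DiscreteMeasurableSpace Y] {c : X → Y → ℝ} (hc : ∀ x y, 0 ≤ c x y) (hμ : Stationary μ)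
    (hν : Stationary ν) {π : Measure ((ℕ → X) × (ℕ → Y))} (h1 : π.map Prod.fst = μ)
    (h2 : π.map Prod.snd = ν) :
    ∃ lam, IsJoining lam μ ν ∧ costOne c lam ≤ ∫ p, cbar c p.1 p.2 ∂π := by
  let _ : TopologicalSpace X := ⊥
  let _ : TopologicalSpace Y := ⊥
  have : DiscreteTopology X := ⟨rfl⟩
  have : DiscreteTopology Y := ⟨rfl⟩
  have := isProbabilityMeasure_of_map measurable_fst h1
  have hT : Continuous (shiftMap2 X Y) := by
    unfold shiftMap2 shiftMap; fun_prop
  obtain ⟨l, Q, hlne, hl, hQ, hinv, hlim⟩ := exists_invariant_limit_orbitAverage (P := π) hT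
  refine ⟨Q, ⟨?_, ?_, hinv⟩, ?_⟩
  · rw [← h1]
    exact map_eq_map_of_tendsto_birkhoffAverage hl hlim continuous_fst (S := shiftMap X)
      (fun _ => rfl) (h1 ▸ ⟨measurable_shiftMap, hμ⟩)
  · rw [← h2]
    exact map_eq_map_of_tendsto_birkhoffAverage hl hlim continuous_snd (S := shiftMap Y)
      (fun _ => rfl) (h2 ▸ ⟨measurable_shiftMap, hν⟩)
  · obtain ⟨C, hC⟩ := exists_cost_le c
    have hcc : Continuous (firstCost c) :=
      (continuous_of_discreteTopology (f := Function.uncurry c)).comp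
        (f := fun p : (ℕ → X) × (ℕ → Y) => (p.1 0, p.2 0)) (by fun_prop)
    simp only [cbar_eq_birkhoffLimsup]
    exact le_integral_birkhoffLimsup measurable_shiftMap2 hcc.measurable (fun _ => hc _ _)
      (fun _ => hC _ _) hl
      (hlim (BoundedContinuousFunction.mkOfCompact ⟨firstCost c, hcc⟩))

end Joinings

section Atoms

variable {α β : Type*} [MeasurableSpace α] [MeasurableSpace β]

lemma measurable_of_eq_on_measurableAtom [Finite α] {f : α → β}
    (h : ∀ a, ∀ b ∈ measurableAtom a, f b = f a) : Measurable f := by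
  intro s _
  have : f ⁻¹' s = ⋃ a ∈ f ⁻¹' s, measurableAtom a := by
    refine Set.Subset.antisymm (fun a ha => Set.mem_iUnion₂.2 ⟨a, ha, mem_measurableAtom_self a⟩)
      (Set.iUnion₂_subset fun a ha b hb => ?_)
    rw [Set.mem_preimage, h a b hb]
    exact ha
  rw [this]
  exact MeasurableSet.biUnion (Set.to_countable _) fun a _ =>
    MeasurableSet.measurableAtom_of_countable a

lemma mem_measurableAtom_comm {a b : α} (h : b ∈ measurableAtom a) : a ∈ measurableAtom b := by
  rw [measurableAtom_eq_of_mem h]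
  exact mem_measurableAtom_self a

lemma apply_mem_measurableAtom {f : α → β} (hf : Measurable f) {a b : α}
    (h : b ∈ measurableAtom a) : f b ∈ measurableAtom (f a) := by
  simp only [measurableAtom, Set.mem_iInter]
  exact fun s hs hsm => mem_of_mem_measurableAtom h (hf hsm) hs

lemma mem_measurableAtom_iff_measurable {a b : α} :
    b ∈ measurableAtom a ↔ Measurable[⊥] fun i : Bool => bif i then a else b := by
  constructor
  · intro h s hs
    refine MeasurableSpace.measurableSet_bot_iff.2 ?_
    by_cases ha : a ∈ s
    · refine Or.inr (Set.eq_univ_of_forall fun i => ?_)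
      cases i
      · exact mem_of_mem_measurableAtom h hs ha
      · exact ha
    · refine Or.inl (Set.eq_empty_of_forall_notMem fun i hi => ?_)
      cases i
      · exact ha (mem_of_mem_measurableAtom (mem_measurableAtom_comm h) hs hi)
      · exact ha hi
  · intro h
    simp only [measurableAtom, Set.mem_iInter]
    intro s ha hs
    rcases MeasurableSpace.measurableSet_bot_iff.1 (h hs) with h' | h'
    · exact absurd (show true ∈ (fun i : Bool => bif i then a else b) ⁻¹' s from ha) (by simp [h'])
    · exact (show false ∈ (fun i : Bool => bif i then a else b) ⁻¹' s by simp [h'])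

lemma pi_mem_measurableAtom {ι : Type*} {x y : ι → α} (h : ∀ i, y i ∈ measurableAtom (x i)) :
    y ∈ measurableAtom x := by
  rw [mem_measurableAtom_iff_measurable]
  refine @measurable_pi_lambda _ _ _ ⊥ _ _ fun i => ?_
  convert mem_measurableAtom_iff_measurable.1 (h i) using 2 with j
  cases j <;> rfl

lemma prod_mem_measurableAtom {p q : α × β} (h1 : q.1 ∈ measurableAtom p.1)
    (h2 : q.2 ∈ measurableAtom p.2) : q ∈ measurableAtom p := by
  rw [mem_measurableAtom_iff_measurable] at *
  convert Measurable.prodMk h1 h2 using 2 with j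
  cases j <;> rfl

lemma apply_eq_of_mem_measurableAtom [MeasurableSingletonClass β] {f : α → β}
    (hf : Measurable f) {a b : α} (h : b ∈ measurableAtom a) : f b = f a :=
  mem_of_mem_measurableAtom h (hf (measurableSet_singleton (f a))) rfl

lemma map_eq_self_of_mem_measurableAtom {R : α → α} (hR : ∀ a, R a ∈ measurableAtom a)
    (m : Measure α) : m.map R = m := by
  have hpre : ∀ s, MeasurableSet s → R ⁻¹' s = s := fun s hs => Set.ext fun a =>
    ⟨fun ha => mem_of_mem_measurableAtom (mem_measurableAtom_comm (hR a)) hs ha,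
      fun ha => mem_of_mem_measurableAtom (hR a) hs ha⟩
  have hRm : Measurable R := fun s hs => (hpre s hs).symm ▸ hs
  ext s hs
  rw [Measure.map_apply hRm hs, hpre s hs]

/-- An almost everywhere strongly measurable function is constant on the atoms outside a null
set. -/
lemma exists_null_eq_on_measurableAtom {m : Measure α} {f : α → ℝ}
    (hf : AEStronglyMeasurable f m) :
    ∃ N : Set α, m N = 0 ∧ ∀ a ∉ N, ∀ b ∈ measurableAtom a, ∀ b' ∈ measurableAtom a,
      f b = f b' := by
  obtain ⟨g, hg, hfg⟩ := hf
  let N := toMeasurable m {a | f a ≠ g a}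
  have hN : ∀ a ∉ N, f a = g a := fun a ha => by
    by_contra hne
    exact ha (subset_toMeasurable m _ hne)
  refine ⟨N, (measure_toMeasurable _).trans hfg, fun a ha => ?_⟩
  have hout : ∀ b ∈ measurableAtom a, f b = g a := fun b hb => by
    rw [hN b (mem_of_mem_measurableAtom hb (measurableSet_toMeasurable _ _).compl ha)]
    exact apply_eq_of_mem_measurableAtom hg.measurable hb
  exact fun b hb b' hb' => (hout b hb).trans (hout b' hb').symm

/-- A finite measurable space is, up to the choice of points in the atoms, a discrete one. -/
lemma exists_discrete_section (α : Type*) [MeasurableSpace α] [Fintype α] :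
    ∃ (q : α → Fin (Fintype.card α)) (s : Fin (Fintype.card α) → α),
      Measurable q ∧ Measurable s ∧ ∀ a, s (q a) ∈ measurableAtom a := by
  let rep : α → α := fun a => Set.Nonempty.some ⟨a, mem_measurableAtom_self a⟩
  have hrep : ∀ a, rep a ∈ measurableAtom a := fun a =>
    Set.Nonempty.some_mem ⟨a, mem_measurableAtom_self a⟩
  have hrep' : ∀ a, ∀ b ∈ measurableAtom a, rep b = rep a := fun a b hb => by
    simp only [rep, measurableAtom_eq_of_mem hb]
  refine ⟨fun a => Fintype.equivFin α (rep a), (Fintype.equivFin α).symm, ?_,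
    .of_discrete, fun a => by simpa using hrep a⟩
  exact measurable_of_eq_on_measurableAtom fun a b hb => by rw [hrep' a b hb]

end Atoms

lemma cbar_nonneg {X Y : Type*} [Fintype X] [Fintype Y] {c : X → Y → ℝ}
    (hc : ∀ x y, 0 ≤ c x y) (x : ℕ → X) (y : ℕ → Y) : 0 ≤ cbar c x y := by
  obtain ⟨C, hC⟩ := exists_cost_le c
  rw [cbar_eq_birkhoffLimsup c (x, y)]
  exact birkhoffLimsup_nonneg (fun _ => hc _ _) (fun _ => hC _ _) _

section MeasurableCost

variable {X Y : Type*} [MeasurableSpace X] [MeasurableSpace Y]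
  {μ : Measure (ℕ → X)} {ν : Measure (ℕ → Y)} {c : X → Y → ℝ}

lemma stationary_map_comp {α β : Type*} [MeasurableSpace α] [MeasurableSpace β]
    {m : Measure (ℕ → α)} (hm : Stationary m) {f : α → β} (hf : Measurable f) :
    Stationary (m.map fun x n => f (x n)) := by
  have hF : Measurable fun (x : ℕ → α) n => f (x n) := by fun_prop
  rw [Stationary, Measure.map_map measurable_shiftMap hF]
  conv_rhs => rw [← hm, Measure.map_map hF measurable_shiftMap]
  rfl

lemma exists_isJoining_costOne_le [Fintype X] [Fintype Y] [IsProbabilityMeasure μ]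
    (hcm : Measurable (Function.uncurry c)) (hc : ∀ x y, 0 ≤ c x y) (hμ : Stationary μ)
    (hν : Stationary ν) {π : Measure ((ℕ → X) × (ℕ → Y))} (h1 : π.map Prod.fst = μ)
    (h2 : π.map Prod.snd = ν) :
    ∃ lam, IsJoining lam μ ν ∧ costOne c lam ≤ ∫ p, cbar c p.1 p.2 ∂π := by
  obtain ⟨q, s, hq, hs, hqs⟩ := exists_discrete_section X
  obtain ⟨q', s', hq', hs', hqs'⟩ := exists_discrete_section Y
  let F : (ℕ → X) → ℕ → Fin (Fintype.card X) := fun x n => q (x n)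
  let F' : (ℕ → Y) → ℕ → Fin (Fintype.card Y) := fun x n => q' (x n)
  let G : (ℕ → Fin (Fintype.card X)) → ℕ → X := fun x n => s (x n)
  let G' : (ℕ → Fin (Fintype.card Y)) → ℕ → Y := fun x n => s' (x n)
  have hF : Measurable F := by fun_prop
  have hF' : Measurable F' := by fun_prop
  have hG : Measurable G := by fun_prop
  have hG' : Measurable G' := by fun_prop
  let d : Fin (Fintype.card X) → Fin (Fintype.card Y) → ℝ := fun i j => c (s i) (s' j)
  have hdm : Measurable (Function.uncurry d) := .of_discrete
  have hd : ∀ x y, d (q x) (q' y) = c x y := fun x y =>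
    apply_eq_of_mem_measurableAtom (a := (x, y)) (b := (s (q x), s' (q' y))) hcm
      (prod_mem_measurableAtom (hqs x) (hqs' y))
  have : IsProbabilityMeasure (μ.map F) := Measure.isProbabilityMeasure_map hF.aemeasurable
  have hm1 : (π.map (Prod.map F F')).map Prod.fst = μ.map F := by
    rw [Measure.map_map measurable_fst (hF.prodMap hF'), ← h1,
      Measure.map_map hF measurable_fst]
    rfl
  have hm2 : (π.map (Prod.map F F')).map Prod.snd = ν.map F' := by
    rw [Measure.map_map measurable_snd (hF.prodMap hF'), ← h2,
      Measure.map_map hF' measurable_snd]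
    rfl
  obtain ⟨lam, ⟨l1, l2, l3⟩, hlam⟩ := exists_isJoining_costOne_le_of_discrete (c := d)
    (fun _ _ => hc _ _) (stationary_map_comp hμ hq) (stationary_map_comp hν hq') hm1 hm2
  have hGG : Measurable (Prod.map G G') := hG.prodMap hG'
  refine ⟨lam.map (Prod.map G G'), ⟨?_, ?_, ?_⟩, ?_⟩
  · calc (lam.map (Prod.map G G')).map Prod.fst = (lam.map Prod.fst).map G := by
          rw [Measure.map_map measurable_fst hGG, Measure.map_map hG measurable_fst]; rfl
      _ = μ.map (G ∘ F) := by rw [l1, Measure.map_map hG hF]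
      _ = μ := map_eq_self_of_mem_measurableAtom
          (fun x => pi_mem_measurableAtom fun n => hqs (x n)) μ
  · calc (lam.map (Prod.map G G')).map Prod.snd = (lam.map Prod.snd).map G' := by
          rw [Measure.map_map measurable_snd hGG, Measure.map_map hG' measurable_snd]; rfl
      _ = ν.map (G' ∘ F') := by rw [l2, Measure.map_map hG' hF']
      _ = ν := map_eq_self_of_mem_measurableAtom
          (fun x => pi_mem_measurableAtom fun n => hqs' (x n)) ν
  · conv_rhs => rw [← l3, Measure.map_map hGG measurable_shiftMap2]
    rw [Measure.map_map measurable_shiftMap2 hGG]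
    rfl
  · calc costOne c (lam.map (Prod.map G G')) = costOne d lam :=
          integral_map hGG.aemeasurable (measurable_firstCost hcm).aestronglyMeasurable
      _ ≤ ∫ p, cbar d p.1 p.2 ∂(π.map (Prod.map F F')) := hlam
      _ = ∫ p, cbar d (F p.1) (F' p.2) ∂π :=
          integral_map (hF.prodMap hF').aemeasurable (measurable_cbar hdm).aestronglyMeasurable
      _ = ∫ p, cbar c p.1 p.2 ∂π := by simp only [cbar, F, F', hd]

lemma costOne_nonneg (hc : ∀ x y, 0 ≤ c x y) (lam : Measure ((ℕ → X) × (ℕ → Y))) :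
    0 ≤ costOne c lam :=
  integral_nonneg fun _ => hc _ _

/-- The equality of the two costs for stationary processes and a measurable one-letter cost. -/
theorem ojCost_eq_otCost_cbar_of_measurable [Fintype X] [Fintype Y] [IsProbabilityMeasure μ]
    [IsProbabilityMeasure ν]
    (hcm : Measurable (Function.uncurry c)) (hc : ∀ x y, 0 ≤ c x y) (hμ : Stationary μ)
    (hν : Stationary ν) : ojCost c μ ν = otCost (fun x y => cbar c x y) μ ν := by
  have hJ := isJoining_prod hμ hν
  obtain ⟨C, hC⟩ := exists_cost_le c
  apply le_antisymm
  · refine le_csInf ⟨_, μ.prod ν, ⟨hJ.1, hJ.2.1⟩, rfl⟩ ?_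
    rintro _ ⟨π, ⟨h1, h2⟩, rfl⟩
    obtain ⟨lam, hlam, hle⟩ := exists_isJoining_costOne_le hcm hc hμ hν h1 h2
    have hbdd : BddBelow (costOne c '' {lam | IsJoining lam μ ν}) :=
      ⟨0, by rintro _ ⟨lam, -, rfl⟩; exact costOne_nonneg hc lam⟩
    exact (csInf_le hbdd ⟨lam, hlam, rfl⟩).trans hle
  · refine le_csInf ⟨_, μ.prod ν, hJ, rfl⟩ ?_
    rintro _ ⟨lam, ⟨h1, h2, h3⟩, rfl⟩
    have hle : otCost (fun x y => cbar c x y) μ ν ≤ ∫ p, cbar c p.1 p.2 ∂lam := by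
      refine csInf_le ⟨0, ?_⟩ ⟨lam, ⟨h1, h2⟩, rfl⟩
      rintro _ ⟨π, -, rfl⟩
      exact integral_nonneg fun p => cbar_nonneg hc p.1 p.2
    refine hle.trans ?_
    have := isProbabilityMeasure_of_map measurable_fst h1
    simp only [cbar_eq_birkhoffLimsup]
    exact integral_birkhoffLimsup_le ⟨measurable_shiftMap2, h3⟩ (measurable_firstCost hcm)
      (fun _ => hc _ _) (fun _ => hC _ _)

end MeasurableCost

section NonmeasurableCost

variable {X Y : Type*} [MeasurableSpace X] [MeasurableSpace Y]
  {μ : Measure (ℕ → X)} {ν : Measure (ℕ → Y)} {c : X → Y → ℝ}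

/-- The probability that the first letter lies in the atom of `a`. -/
def atomMass {α : Type*} [MeasurableSpace α] (m : Measure (ℕ → α)) (a : α) : ENNReal :=
  m {x | x 0 ∈ measurableAtom a}

open Classical in
/-- Replace the pairs of letters lying in the product of the atoms of `a` and `b` by `(x, y)`. -/
def replacePair (a : X) (b : Y) (x : X) (y : Y) (p : (ℕ → X) × (ℕ → Y)) :
    (ℕ → X) × (ℕ → Y) :=
  (fun n => if p.1 n ∈ measurableAtom a ∧ p.2 n ∈ measurableAtom b then x else p.1 n,
    fun n => if p.1 n ∈ measurableAtom a ∧ p.2 n ∈ measurableAtom b then y else p.2 n)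

open Classical in
/-- The indicator of the complement of the product of the atoms of `a` and `b`. -/
def offAtom (a : X) (b : Y) (x : X) (y : Y) : ℝ :=
  if x ∈ measurableAtom a ∧ y ∈ measurableAtom b then 0 else 1

lemma replacePair_mem_measurableAtom {a x : X} {b y : Y} (hx : x ∈ measurableAtom a)
    (hy : y ∈ measurableAtom b) (p : (ℕ → X) × (ℕ → Y)) :
    replacePair a b x y p ∈ measurableAtom p := by
  refine prod_mem_measurableAtom (pi_mem_measurableAtom fun n => ?_)
    (pi_mem_measurableAtom fun n => ?_)
  · simp only [replacePair]
    split_ifs with h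
    · rwa [measurableAtom_eq_of_mem h.1]
    · exact mem_measurableAtom_self _
  · simp only [replacePair]
    split_ifs with h
    · rwa [measurableAtom_eq_of_mem h.2]
    · exact mem_measurableAtom_self _

lemma offAtom_nonneg (a : X) (b : Y) (x : X) (y : Y) : 0 ≤ offAtom a b x y := by
  unfold offAtom; split_ifs <;> norm_num

lemma offAtom_le_one (a : X) (b : Y) (x : X) (y : Y) : offAtom a b x y ≤ 1 := by
  unfold offAtom; split_ifs <;> norm_num

lemma measurable_offAtom [Fintype X] [Fintype Y] (a : X) (b : Y) :
    Measurable (Function.uncurry (offAtom a b)) := by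
  classical
  exact Measurable.ite ((MeasurableSet.measurableAtom_of_countable a).prod
    (MeasurableSet.measurableAtom_of_countable b)) measurable_const measurable_const

lemma cbar_replacePair_lt [Fintype X] [Fintype Y] {a x x' : X} {b y y' : Y} (hc : ∀ x y, 0 ≤ c x y)
    (hlt : c x y < c x' y') {p : (ℕ → X) × (ℕ → Y)} (hp : cbar (offAtom a b) p.1 p.2 < 1) :
    cbar c (replacePair a b x y p).1 (replacePair a b x y p).2
      < cbar c (replacePair a b x' y' p).1 (replacePair a b x' y' p).2 := by
  obtain ⟨C, hC⟩ := exists_cost_le c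
  obtain ⟨θ, hθ, hθ1⟩ := exists_between hp
  simp only [cbar_eq_birkhoffLimsup] at hθ ⊢
  set P := replacePair a b x y p with hP
  set P' := replacePair a b x' y' p with hP'
  have hC0 : 0 ≤ C := (hc x y).trans (hC x y)
  have hδ : 0 < (c x' y' - c x y) * (1 - θ) := mul_pos (sub_pos.2 hlt) (sub_pos.2 hθ1)
  have hbd := fun r => isBoundedUnder_le_birkhoffAverage (T := shiftMap2 X Y)
    (f := firstCost c) hC0 (fun _ => hC _ _) r
  have e1 := eventually_lt_of_limsup_lt hθ (isBoundedUnder_le_birkhoffAverage zero_le_one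
    (fun _ => offAtom_le_one a b _ _) p)
  have e2 := eventually_lt_of_limsup_lt
    (lt_add_of_pos_right (birkhoffLimsup (shiftMap2 X Y) (firstCost c) P') (half_pos hδ)) (hbd P')
  have key : birkhoffLimsup (shiftMap2 X Y) (firstCost c) P
      ≤ birkhoffLimsup (shiftMap2 X Y) (firstCost c) P'
        - (c x' y' - c x y) * (1 - θ) / 2 := by
    refine limsup_le_of_le (isBoundedUnder_ge_birkhoffAverage (fun _ => hc _ _)
      P).isCoboundedUnder_le ?_
    filter_upwards [e1, e2, eventually_gt_atTop 0] with n h1 h2 hn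
    have hterm : ∀ i, c (P'.1 i) (P'.2 i)
        = c (P.1 i) (P.2 i) + (c x' y' - c x y) * (1 - offAtom a b (p.1 i) (p.2 i)) := by
      intro i
      simp only [hP, hP', replacePair, offAtom]
      split_ifs <;> ring
    have havg : birkhoffAverage ℝ (shiftMap2 X Y) (firstCost c) n P'
        = birkhoffAverage ℝ (shiftMap2 X Y) (firstCost c) n P + (c x' y' - c x y)
          * (1 - birkhoffAverage ℝ (shiftMap2 X Y) (firstCost (offAtom a b)) n p) := by
      have hn' : (n : ℝ) ≠ 0 := by positivity
      simp only [birkhoffAverage_eq_div, firstCost_iterate, hterm, Finset.sum_add_distrib,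
        ← Finset.mul_sum, Finset.sum_sub_distrib, Finset.sum_const, Finset.card_range,
        nsmul_eq_mul, mul_one]
      field_simp
    have h3 := mul_le_mul_of_nonneg_left (sub_le_sub_left h1.le 1) (sub_pos.2 hlt).le
    linarith
  linarith

lemma prod_firstLetter_atom [IsProbabilityMeasure μ] [IsProbabilityMeasure ν] (a : X) (b : Y) :
    (μ.prod ν) {p | p.1 0 ∈ measurableAtom a ∧ p.2 0 ∈ measurableAtom b}
      = atomMass μ a * atomMass ν b :=
  Measure.prod_prod {x : ℕ → X | x 0 ∈ measurableAtom a} {y : ℕ → Y | y 0 ∈ measurableAtom b}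

lemma measurableSet_firstLetter_atom {α : Type*} [Finite α] [MeasurableSpace α] (a : α) :
    MeasurableSet {x : ℕ → α | x 0 ∈ measurableAtom a} :=
  measurable_pi_apply 0 (MeasurableSet.measurableAtom_of_countable a)

lemma not_aestronglyMeasurable_firstCost [Fintype X] [Fintype Y] [IsProbabilityMeasure μ]
    [IsProbabilityMeasure ν]
    {a x x' : X} {b y y' : Y} (ha : atomMass μ a ≠ 0) (hb : atomMass ν b ≠ 0)
    (hx : x ∈ measurableAtom a) (hx' : x' ∈ measurableAtom a) (hy : y ∈ measurableAtom b)
    (hy' : y' ∈ measurableAtom b) (hlt : c x y < c x' y') :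
    ¬ AEStronglyMeasurable (firstCost c) (μ.prod ν) := by
  intro h
  obtain ⟨N, hN, hconst⟩ := exists_null_eq_on_measurableAtom h
  have hpos := mul_ne_zero ha hb
  rw [← prod_firstLetter_atom] at hpos
  obtain ⟨p, hp, hpN⟩ := Set.not_subset.1 fun hsub => hpos (measure_mono_null hsub hN)
  have := hconst p hpN _ (replacePair_mem_measurableAtom hx hy p) _
    (replacePair_mem_measurableAtom hx' hy' p)
  rw [Set.mem_ofPred_eq] at hp
  simp only [firstCost, replacePair, if_pos hp] at this
  exact hlt.ne this

lemma not_aestronglyMeasurable_cbar [Fintype X] [Fintype Y] [IsProbabilityMeasure μ]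
    [IsProbabilityMeasure ν]
    (hμ : Stationary μ) (hν : Stationary ν) (hc : ∀ x y, 0 ≤ c x y)
    {a x x' : X} {b y y' : Y} (ha : atomMass μ a ≠ 0) (hb : atomMass ν b ≠ 0)
    (hx : x ∈ measurableAtom a) (hx' : x' ∈ measurableAtom a) (hy : y ∈ measurableAtom b)
    (hy' : y' ∈ measurableAtom b) (hlt : c x y < c x' y') :
    ¬ AEStronglyMeasurable (fun p : (ℕ → X) × (ℕ → Y) => cbar c p.1 p.2) (μ.prod ν) := by
  intro h
  obtain ⟨N, hN, hconst⟩ := exists_null_eq_on_measurableAtom h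
  obtain ⟨p, hpN, hp⟩ : ∃ p ∉ N, cbar (offAtom a b) p.1 p.2 < 1 := by
    by_contra! hge
    have hdm := measurable_firstCost (measurable_offAtom a b)
    have h1 : 1 ≤ ∫ p, birkhoffLimsup (shiftMap2 X Y) (firstCost (offAtom a b)) p
        ∂(μ.prod ν) := by
      calc (1 : ℝ) = ∫ _p : (ℕ → X) × (ℕ → Y), (1 : ℝ) ∂(μ.prod ν) := by simp
        _ ≤ _ := integral_mono_ae (integrable_const 1)
          (integrable_of_nonneg_of_le (measurable_birkhoffLimsup measurable_shiftMap2 hdm)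
            (birkhoffLimsup_nonneg (fun _ => offAtom_nonneg a b _ _)
              fun _ => offAtom_le_one a b _ _)
            (birkhoffLimsup_le (fun _ => offAtom_nonneg a b _ _)
              fun _ => offAtom_le_one a b _ _)) ?_
      filter_upwards [measure_eq_zero_iff_ae_notMem.1 hN] with p hp
      rw [← cbar_eq_birkhoffLimsup]
      exact hge p hp
    have h2 := integral_birkhoffLimsup_le (T := shiftMap2 X Y) (P := μ.prod ν)
      ⟨measurable_shiftMap2, (isJoining_prod hμ hν).2.2⟩ hdm
      (fun _ => offAtom_nonneg a b _ _) (fun _ => offAtom_le_one a b _ _)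
    let D : Set ((ℕ → X) × (ℕ → Y)) := {p | p.1 0 ∈ measurableAtom a ∧ p.2 0 ∈ measurableAtom b}
    have hDm : MeasurableSet D :=
      (measurableSet_firstLetter_atom a).prod (measurableSet_firstLetter_atom b)
    have h3 : ∫ p, firstCost (offAtom a b) p ∂(μ.prod ν) = (μ.prod ν).real Dᶜ := by
      rw [← integral_indicator_one hDm.compl]
      congr 1
      funext p
      by_cases hp : p ∈ D
      · rw [Set.indicator_of_notMem (by simpa using hp)]
        exact if_pos hp
      · rw [Set.indicator_of_mem hp]
        exact if_neg hp
    have h4 : 0 < (μ.prod ν).real D := by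
      rw [Measure.real, ENNReal.toReal_pos_iff]
      refine ⟨pos_iff_ne_zero.2 ?_, measure_lt_top _ _⟩
      rw [prod_firstLetter_atom]
      exact mul_ne_zero ha hb
    rw [h3, probReal_compl_eq_one_sub hDm] at h2
    linarith
  exact (cbar_replacePair_lt hc hlt hp).ne (hconst p hpN _
    (replacePair_mem_measurableAtom hx hy p) _ (replacePair_mem_measurableAtom hx' hy' p))

/-- If the one-letter cost is not constant on some product of atoms of positive mass, then the
costs of the product coupling are integrals of nonmeasurable functions, and vanish. -/
lemma ojCost_eq_otCost_cbar_of_lt_on_atom [Fintype X] [Fintype Y] [IsProbabilityMeasure μ]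
    [IsProbabilityMeasure ν]
    (hμ : Stationary μ) (hν : Stationary ν) (hc : ∀ x y, 0 ≤ c x y)
    {a x x' : X} {b y y' : Y} (ha : atomMass μ a ≠ 0) (hb : atomMass ν b ≠ 0)
    (hx : x ∈ measurableAtom a) (hx' : x' ∈ measurableAtom a) (hy : y ∈ measurableAtom b)
    (hy' : y' ∈ measurableAtom b) (hlt : c x y < c x' y') :
    ojCost c μ ν = otCost (fun x y => cbar c x y) μ ν := by
  have hJ := isJoining_prod hμ hν
  have h1 : ojCost c μ ν = 0 := by
    refine IsLeast.csInf_eq ⟨⟨μ.prod ν, hJ, ?_⟩, ?_⟩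
    · exact integral_non_aestronglyMeasurable
        (not_aestronglyMeasurable_firstCost ha hb hx hx' hy hy' hlt)
    · rintro _ ⟨lam, -, rfl⟩
      exact costOne_nonneg hc lam
  have h2 : otCost (fun x y => cbar c x y) μ ν = 0 := by
    refine IsLeast.csInf_eq ⟨⟨μ.prod ν, ⟨hJ.1, hJ.2.1⟩, ?_⟩, ?_⟩
    · exact integral_non_aestronglyMeasurable
        (not_aestronglyMeasurable_cbar hμ hν hc ha hb hx hx' hy hy' hlt)
    · rintro _ ⟨π, -, rfl⟩
      exact integral_nonneg fun p => cbar_nonneg hc p.1 p.2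
  rw [h1, h2]

lemma ae_forall_atomMass_ne_zero {α : Type*} [Finite α] [MeasurableSpace α]
    {m : Measure (ℕ → α)} (hm : Stationary m) : ∀ᵐ x ∂m, ∀ n, atomMass m (x n) ≠ 0 := by
  have h0 : ∀ᵐ x ∂m, atomMass m (x 0) ≠ 0 := by
    have : ∀ᵐ x ∂m, ∀ a, atomMass m a = 0 → x 0 ∉ measurableAtom a :=
      ae_all_iff.2 fun a => by
        by_cases ha : atomMass m a = 0
        · filter_upwards [measure_eq_zero_iff_ae_notMem.1 ha] with x hx _ using hx
        · exact Eventually.of_forall fun x h => absurd h ha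
    filter_upwards [this] with x hx h
    exact hx _ h (mem_measurableAtom_self _)
  refine ae_all_iff.2 fun n => ?_
  have hS : MeasurePreserving (shiftMap α)^[n] m m :=
    MeasurePreserving.iterate ⟨measurable_shiftMap, hm⟩ n
  have hit : ∀ (n : ℕ) (x : ℕ → α), (shiftMap α)^[n] x 0 = x n := by
    intro n
    induction n with
    | zero => exact fun _ => rfl
    | succ n ih => intro x; rw [Function.iterate_succ_apply, ih]; rfl
  filter_upwards [hS.quasiMeasurePreserving.ae h0] with x hx
  rwa [hit] at hx

lemma ae_forall_eq_of_eq_of_atomMass_ne_zero [Fintype X] [Fintype Y] {d : X → Y → ℝ}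
    (hμ : Stationary μ)
    (hν : Stationary ν) (hd : ∀ x y, atomMass μ x ≠ 0 → atomMass ν y ≠ 0 → c x y = d x y)
    {π : Measure ((ℕ → X) × (ℕ → Y))} (h1 : π.map Prod.fst = μ) (h2 : π.map Prod.snd = ν) :
    ∀ᵐ p ∂π, ∀ n, c (p.1 n) (p.2 n) = d (p.1 n) (p.2 n) := by
  have e1 := ae_of_ae_map measurable_fst.aemeasurable
    (h1.symm ▸ ae_forall_atomMass_ne_zero hμ : ∀ᵐ x ∂π.map Prod.fst, ∀ n, atomMass μ (x n) ≠ 0)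
  have e2 := ae_of_ae_map measurable_snd.aemeasurable
    (h2.symm ▸ ae_forall_atomMass_ne_zero hν : ∀ᵐ y ∂π.map Prod.snd, ∀ n, atomMass ν (y n) ≠ 0)
  filter_upwards [e1, e2] with p h1 h2 n using hd _ _ (h1 n) (h2 n)

lemma ojCost_congr [Fintype X] [Fintype Y] {d : X → Y → ℝ} (hμ : Stationary μ) (hν : Stationary ν)
    (hd : ∀ x y, atomMass μ x ≠ 0 → atomMass ν y ≠ 0 → c x y = d x y) :
    ojCost c μ ν = ojCost d μ ν := by
  refine congrArg sInf (Set.image_congr fun lam hlam => integral_congr_ae ?_)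
  filter_upwards [ae_forall_eq_of_eq_of_atomMass_ne_zero hμ hν hd hlam.1 hlam.2.1] with p hp
    using hp 0

lemma otCost_cbar_congr [Fintype X] [Fintype Y] {d : X → Y → ℝ} (hμ : Stationary μ)
    (hν : Stationary ν)
    (hd : ∀ x y, atomMass μ x ≠ 0 → atomMass ν y ≠ 0 → c x y = d x y) :
    otCost (fun x y => cbar c x y) μ ν = otCost (fun x y => cbar d x y) μ ν := by
  refine congrArg sInf (Set.image_congr fun π hπ => integral_congr_ae ?_)
  filter_upwards [ae_forall_eq_of_eq_of_atomMass_ne_zero hμ hν hd hπ.1 hπ.2] with p hp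
  simp only [cbar, hp]

end NonmeasurableCost

/-- the optimal joining cost equals the optimal transport cost for the
limiting average cost `c̄`. -/
theorem ojCost_eq_otCost_cbar {X Y : Type*} [Fintype X] [Fintype Y]
    [MeasurableSpace X] [MeasurableSpace Y]
    (c : X → Y → ℝ) (hc : ∀ x y, 0 ≤ c x y)
    (μ : Measure (ℕ → X)) (ν : Measure (ℕ → Y))
    [IsProbabilityMeasure μ] [IsProbabilityMeasure ν]
    (hμ : Ergodic (shiftMap X) μ) (hν : Ergodic (shiftMap Y) ν) :
    ojCost c μ ν = otCost (fun x y => cbar c x y) μ ν := by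
  classical
  have sμ : Stationary μ := hμ.toMeasurePreserving.map_eq
  have sν : Stationary ν := hν.toMeasurePreserving.map_eq
  by_cases hatom : ∃ a x x' b y y', atomMass μ a ≠ 0 ∧ atomMass ν b ≠ 0 ∧
      x ∈ measurableAtom a ∧ x' ∈ measurableAtom a ∧ y ∈ measurableAtom b ∧
      y' ∈ measurableAtom b ∧ c x y < c x' y'
  · obtain ⟨a, x, x', b, y, y', ha, hb, hx, hx', hy, hy', hlt⟩ := hatom
    exact ojCost_eq_otCost_cbar_of_lt_on_atom sμ sν hc ha hb hx hx' hy hy' hlt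
  · push Not at hatom
    let d : X → Y → ℝ := fun x y => if atomMass μ x ≠ 0 ∧ atomMass ν y ≠ 0 then c x y else 0
    have hcd : ∀ x y, atomMass μ x ≠ 0 → atomMass ν y ≠ 0 → c x y = d x y :=
      fun x y hx hy => (if_pos ⟨hx, hy⟩).symm
    have hd : ∀ x y, 0 ≤ d x y := fun x y => by
      simp only [d]
      split_ifs
      exacts [hc x y, le_rfl]
    have hdm : Measurable (Function.uncurry d) := by
      refine measurable_of_eq_on_measurableAtom fun p q hq => ?_
      have h1 : q.1 ∈ measurableAtom p.1 := apply_mem_measurableAtom measurable_fst hq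
      have h2 : q.2 ∈ measurableAtom p.2 := apply_mem_measurableAtom measurable_snd hq
      have hm1 : atomMass μ q.1 = atomMass μ p.1 := by
        simp only [atomMass, measurableAtom_eq_of_mem h1]
      have hm2 : atomMass ν q.2 = atomMass ν p.2 := by
        simp only [atomMass, measurableAtom_eq_of_mem h2]
      simp only [Function.uncurry, d, hm1, hm2]
      split_ifs with hpos
      · have s1 := mem_measurableAtom_self p.1
        have s2 := mem_measurableAtom_self p.2
        exact le_antisymm (hatom p.1 p.1 q.1 p.2 p.2 q.2 hpos.1 hpos.2 s1 h1 s2 h2)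
          (hatom p.1 q.1 p.1 p.2 q.2 p.2 hpos.1 hpos.2 h1 s1 h2 s2)
      · rfl
    rw [ojCost_congr sμ sν hcd, otCost_cbar_congr sμ sν hcd]
    exact ojCost_eq_otCost_cbar_of_measurable hdm hd sμ sν

end
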